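/- Let s ≥ 1/4, 0 < T < ∞ and R > 0. The gauge transformation NT maps the closed ball {u ∈ C([−T,T]; H^s(𝕋)) : sup_{t∈[−T,T]}‖u(t)‖_{H^s(𝕋)} ≤ R} of real-valued functions into C([−T,T]; H^s(𝕋)), is injective on this ball, and is bi-continuous there: both NT and its inverse (defined on the image) are continuous with respect to the C([−T,T]; H^s(𝕋)) topology. In particular, if u_ℓ, u are in the ball and NT(u_ℓ) → NT(u) in C([−T,T]; H^s(𝕋)), then u_ℓ → u in C([−T,T]; H^s(𝕋)), and conversely. -/

import Mathlib

noncomputable section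

open scoped BigOperators ComplexConjugate
open MeasureTheory Complex Set

namespace MKdV5

/-! ### Sobolev data on the Fourier side.

A function `u ∈ H^s(𝕋)` (with `𝕋 = ℝ/2πℤ`) is represented by its sequence of Fourier
coefficients `a : ℤ → ℂ`, `a n = û(n) = (2π)^{-1/2}∫_𝕋 e^{-inx}u(x)dx`; real-valuedness of `u`
corresponds to `conj (a n) = a (-n)`. -/

/-- The weight `(1+n²)^s` of the `H^s(𝕋)` norm. -/
def hsWeight (s : ℝ) (n : ℤ) : ℝ := (1 + (n : ℝ) ^ 2) ^ s

/-- `a` is (the sequence of Fourier coefficients of) an element of `H^s(𝕋)`. -/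
def InHs (s : ℝ) (a : ℤ → ℂ) : Prop := Summable fun n : ℤ => hsWeight s n * ‖a n‖ ^ 2

/-- The square of the `H^s(𝕋)` norm. -/
def hsNormSq (s : ℝ) (a : ℤ → ℂ) : ℝ := ∑' n : ℤ, hsWeight s n * ‖a n‖ ^ 2

/-- The `H^s(𝕋)` norm. -/
def hsNorm (s : ℝ) (a : ℤ → ℂ) : ℝ := Real.sqrt (hsNormSq s a)

/-- The Fourier coefficients of a real-valued function satisfy `conj (a n) = a (-n)`. -/
def IsRealCoeff (a : ℤ → ℂ) : Prop := ∀ n : ℤ, conj (a n) = a (-n)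

/-- `u ∈ C([-T,T]; H^s(𝕋))`, on the Fourier side. -/
def ContHs (s T : ℝ) (u : ℝ → ℤ → ℂ) : Prop :=
  (∀ t ∈ Icc (-T) T, InHs s (u t)) ∧
    ∀ t ∈ Icc (-T) T, ∀ ε > 0, ∃ δ > 0, ∀ t' ∈ Icc (-T) T,
      |t' - t| < δ → hsNorm s (fun n => u t' n - u t n) < ε

/-- `u ∈ C([-T,T]; H^∞(𝕋))`. -/
def ContHinf (T : ℝ) (u : ℝ → ℤ → ℂ) : Prop := ∀ s : ℝ, ContHs s T u

/-- The nonresonance condition defining `𝒩_{3,n}`. -/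
abbrev N3cond (n₁ n₂ n₃ : ℤ) : Prop := (n₁ + n₂) * (n₁ + n₃) * (n₂ + n₃) ≠ 0

/-- The nonresonance condition defining `𝒩_{5,n}`: no four of the five frequencies sum to zero. -/
abbrev N5cond (n₁ n₂ n₃ n₄ n₅ : ℤ) : Prop :=
  n₁ + n₂ + n₃ + n₄ ≠ 0 ∧ n₁ + n₂ + n₃ + n₅ ≠ 0 ∧ n₁ + n₂ + n₄ + n₅ ≠ 0 ∧
    n₁ + n₃ + n₄ + n₅ ≠ 0 ∧ n₂ + n₃ + n₄ + n₅ ≠ 0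

/-- Sum over `(n₁,n₂,n₃) ∈ 𝒩_{3,n}` of `K(n₁,n₂,n₃)·a(n₁)b(n₂)c(n₃)`. -/
def cubicN3Sum (K : ℤ → ℤ → ℤ → ℂ) (a b c : ℤ → ℂ) (n : ℤ) : ℂ :=
  ∑' p : ℤ × ℤ, if N3cond p.1 p.2 (n - p.1 - p.2) then
    K p.1 p.2 (n - p.1 - p.2) * a p.1 * b p.2 * c (n - p.1 - p.2) else 0

/-- Sum over `(n₁,…,n₅) ∈ 𝒩_{5,n}` of `a₁(n₁)⋯a₅(n₅)`. -/
def quinticN5Sum (a₁ a₂ a₃ a₄ a₅ : ℤ → ℂ) (n : ℤ) : ℂ :=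
  ∑' q : ℤ × ℤ × ℤ × ℤ,
    if N5cond q.1 q.2.1 q.2.2.1 q.2.2.2 (n - q.1 - q.2.1 - q.2.2.1 - q.2.2.2) then
      a₁ q.1 * a₂ q.2.1 * a₃ q.2.2.1 * a₄ q.2.2.2 * a₅ (n - q.1 - q.2.1 - q.2.2.1 - q.2.2.2)
    else 0

/-- The dispersion relation `μ(n) = n⁵ + d₁n³ + d₂n`. -/
def muPhase (d₁ d₂ : ℝ) (n : ℤ) : ℝ := (n : ℝ) ^ 5 + d₁ * (n : ℝ) ^ 3 + d₂ * (n : ℝ)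

end MKdV5

namespace MKdV5

/-! ### The gauge transformation `NT` and the conserved quantities of low order. -/

/-- `‖u‖_{L⁴(𝕋)}⁴ = ∫_𝕋 u⁴ dx`, computed on the Fourier side (a complex number which is
real for real-valued `u`). -/
def l4pow (a : ℤ → ℂ) : ℂ :=
  ((2 * Real.pi : ℝ) : ℂ)⁻¹ *
    ∑' q : ℤ × ℤ × ℤ, a q.1 * a q.2.1 * a q.2.2 * a (-(q.1 + q.2.1 + q.2.2))

/-- The gauge transformation `NT`:
`NT(u)^(t,n) = e^{-20in∫₀ᵗ ‖u(σ)‖_{L⁴}⁴ dσ} û(t,n)`. -/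
def gauge (u : ℝ → ℤ → ℂ) : ℝ → ℤ → ℂ := fun t n =>
  Complex.exp (-(20 : ℂ) * I * (n : ℂ) * ∫ τ in (0:ℝ)..t, l4pow (u τ)) * u t n

/-- `∫_𝕋 u² dx` on the Fourier side (for real-valued `u`). -/
def mass (a : ℤ → ℂ) : ℝ := ∑' n : ℤ, ‖a n‖ ^ 2

/-- `∫_𝕋 (∂ₓu)² + u⁴ dx` on the Fourier side (for real-valued `u`). -/
def energy1 (a : ℤ → ℂ) : ℝ := (∑' n : ℤ, (n : ℝ) ^ 2 * ‖a n‖ ^ 2) + (l4pow a).re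

end MKdV5

namespace MKdV5

/-- The closed ball of radius `R` of real-valued functions in `C([-T,T];H^s(𝕋))`. -/
def InBallCHs (s T R : ℝ) (u : ℝ → ℤ → ℂ) : Prop :=
  ContHs s T u ∧ (∀ t ∈ Icc (-T) T, IsRealCoeff (u t)) ∧
    ∀ t ∈ Icc (-T) T, hsNorm s (u t) ≤ R

/-- The `C([-T,T];H^s)` distance between two (Fourier-side) functions. -/
def supDistHs (s T : ℝ) (u v : ℝ → ℤ → ℂ) : ℝ :=
  sSup ((fun t : ℝ => hsNorm s fun n => u t n - v t n) '' Icc (-T) T)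

/-! ### The quadrilinear estimate at regularity `1/4`. -/

/-- The weight `(1 + |n|)^{1/4}`. -/
def quarterWeight (n : ℤ) : ℝ := (1 + |(n : ℝ)|) ^ (1 / 4 : ℝ)

lemma quarterWeight_pos (n : ℤ) : 0 < quarterWeight n := by
  unfold quarterWeight; positivity

lemma quarterWeight_pow_four (n : ℤ) : quarterWeight n ^ 4 = 1 + |(n : ℝ)| := by
  unfold quarterWeight
  rw [← Real.rpow_natCast, ← Real.rpow_mul (by positivity)]
  norm_num

/-- Telescoping bound for one summand `j^{-3/4}`. -/
lemma inv_cube_le_sub {p q : ℝ} (hp : 0 ≤ p) (hq : 0 < q) (h : q ^ 4 = p ^ 4 + 1) :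
    (q ^ 3)⁻¹ ≤ 4 * (q - p) := by
  have hpq : p ≤ q := by
    by_contra! hlt
    have := pow_lt_pow_left₀ hlt hq.le (n := 4) (by norm_num)
    linarith
  rw [inv_le_iff_one_le_mul₀ (by positivity)]
  have h1 : 1 = (q - p) * (q ^ 3 + q ^ 2 * p + q * p ^ 2 + p ^ 3) := by linear_combination -h
  have h2 : q ^ 3 + q ^ 2 * p + q * p ^ 2 + p ^ 3 ≤ 4 * q ^ 3 := by
    have e1 : q ^ 2 * p ≤ q ^ 2 * q := by gcongr
    have e2 : q * p ^ 2 ≤ q * q ^ 2 := by gcongr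
    have e3 : p ^ 3 ≤ q ^ 3 := by gcongr
    linarith
  nlinarith [mul_le_mul_of_nonneg_left h2 (sub_nonneg.2 hpq)]

/-- Telescoping bound for one summand `j^{-5/4}`. -/
lemma inv_pow_five_le_sub {p q : ℝ} (hp : 0 < p) (hq : 0 < q) (h : q ^ 4 = p ^ 4 + 1) :
    (q ^ 3)⁻¹ * (q ^ 2)⁻¹ ≤ 4 * (p⁻¹ - q⁻¹) := by
  have hpq : p ≤ q := by
    by_contra! hlt
    have := pow_lt_pow_left₀ hlt hq.le (n := 4) (by norm_num)
    linarith
  have h1 := inv_cube_le_sub hp.le hq h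
  have h2 : 4 * (p⁻¹ - q⁻¹) = 4 * (q - p) * (p⁻¹ * q⁻¹) := by
    field_simp
  rw [h2]
  have h3 : (q ^ 2)⁻¹ ≤ p⁻¹ * q⁻¹ := by
    rw [← mul_inv]
    apply inv_anti₀ (by positivity)
    nlinarith
  have h4 : 0 ≤ (q ^ 3)⁻¹ := by positivity
  exact mul_le_mul h1 h3 (by positivity) (h4.trans h1)

lemma sum_range_schur_le (N : ℕ) (hN : 0 < N) (M : ℕ) :
    ∑ j ∈ Finset.range M, ((quarterWeight j ^ 3)⁻¹ *
      ((max (quarterWeight (N - 1 : ℤ)) (quarterWeight j)) ^ 2)⁻¹) ≤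
      8 * (quarterWeight (N - 1 : ℤ))⁻¹ := by
  set r : ℕ → ℝ := fun j => (j : ℝ) ^ (1 / 4 : ℝ) with hr
  have r0 : ∀ j, 0 ≤ r j := fun j => by simp only [hr]; positivity
  have rpos : ∀ j, 0 < j → 0 < r j := fun j hj => by simp only [hr]; positivity
  have r4 : ∀ j, r j ^ 4 = j := fun j => by
    simp only [hr]
    rw [← Real.rpow_natCast, ← Real.rpow_mul (by positivity)]
    norm_num
  have rmono : ∀ i j, i ≤ j → r i ≤ r j := fun i j hij => by
    simp only [hr]; gcongr
  have hq : ∀ j : ℕ, quarterWeight j = r (j + 1) := fun j => by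
    simp [quarterWeight, hr, add_comm]
  have hqN : quarterWeight (N - 1 : ℤ) = r N := by
    obtain ⟨k, rfl⟩ : ∃ k, N = k + 1 := ⟨N - 1, by omega⟩
    rw [← hq]; simp
  rw [hqN]
  simp only [hq]
  have rs : ∀ j : ℕ, r (j + 1) ^ 4 = r j ^ 4 + 1 := fun j => by rw [r4, r4]; push_cast; ring
  have small : ∀ M ≤ N, ∑ j ∈ Finset.range M, ((r (j + 1) ^ 3)⁻¹ *
      ((max (r N) (r (j + 1))) ^ 2)⁻¹) ≤ 4 * r M * (r N ^ 2)⁻¹ := by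
    intro M
    induction M with
    | zero =>
      intro _
      simp only [Finset.range_zero, Finset.sum_empty]
      have := r0 0
      positivity
    | succ M ih =>
      intro hM
      rw [Finset.sum_range_succ, max_eq_left (rmono _ _ hM)]
      have h1 := ih (by omega)
      have h2 := inv_cube_le_sub (r0 M) (rpos (M + 1) (by omega)) (rs M)
      have h3 : 0 ≤ (r N ^ 2)⁻¹ := by positivity
      have h4 := mul_le_mul_of_nonneg_right h2 h3
      linarith
  have hNN := rpos N hN
  have e : r N * (r N ^ 2)⁻¹ = (r N)⁻¹ := by field_simp
  have large : ∀ k, ∑ j ∈ Finset.range (N + k), ((r (j + 1) ^ 3)⁻¹ *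
      ((max (r N) (r (j + 1))) ^ 2)⁻¹) ≤ 8 * (r N)⁻¹ - 4 * (r (N + k))⁻¹ := by
    intro k
    induction k with
    | zero =>
      have := small N le_rfl
      rw [mul_assoc, e] at this
      simp only [add_zero]
      linarith
    | succ k ih =>
      rw [← add_assoc, Finset.sum_range_succ, max_eq_right (rmono _ _ (by omega))]
      have h2 := inv_pow_five_le_sub (rpos (N + k) (by omega)) (rpos (N + k + 1) (by omega))
        (rs (N + k))
      linarith
  rcases le_total M N with h | h
  · refine (small M h).trans ?_
    rw [← e, ← mul_assoc]
    have := rmono _ _ h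
    gcongr
    norm_num
  · obtain ⟨k, rfl⟩ := Nat.exists_eq_add_of_le h
    refine (large k).trans ?_
    have := r0 (N + k)
    have : 0 ≤ (r (N + k))⁻¹ := by positivity
    linarith

lemma quarterWeight_natAbs (n : ℤ) : quarterWeight (n.natAbs : ℤ) = quarterWeight n := by
  simp [quarterWeight]

lemma tsum_schur_le (n : ℤ) :
    ∑' m : ℤ, ENNReal.ofReal ((quarterWeight m ^ 3)⁻¹ *
      ((max (quarterWeight n) (quarterWeight m)) ^ 2)⁻¹) ≤
      ENNReal.ofReal (16 * (quarterWeight n)⁻¹) := by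
  set g : ℤ → ENNReal := fun m => ENNReal.ofReal ((quarterWeight m ^ 3)⁻¹ *
      ((max (quarterWeight n) (quarterWeight m)) ^ 2)⁻¹) with hg
  have geven : ∀ m : ℤ, g (-m) = g m := fun m => by simp [hg, quarterWeight]
  have hnat : ∑' j : ℕ, g j ≤ ENNReal.ofReal (8 * (quarterWeight n)⁻¹) := by
    rw [ENNReal.tsum_eq_iSup_nat]
    refine iSup_le fun M => ?_
    have h := sum_range_schur_le (n.natAbs + 1) (by omega) M
    have e : quarterWeight (((n.natAbs + 1 : ℕ) : ℤ) - 1) = quarterWeight n := by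
      rw [← quarterWeight_natAbs n]; congr 1; push_cast; ring
    rw [e] at h
    simp only [hg]
    rw [← ENNReal.ofReal_sum_of_nonneg]
    · exact ENNReal.ofReal_le_ofReal h
    · intro j _
      have := quarterWeight_pos j
      positivity
  have hle : ∑' m : ℤ, g m ≤ ∑' j : ℕ, g j + ∑' j : ℕ, g j := by
    rw [tsum_of_nat_of_neg_add_one (f := g) ENNReal.summable ENNReal.summable]
    refine add_le_add le_rfl ?_
    calc ∑' j : ℕ, g (-(j + 1)) = ∑' j : ℕ, g ((j + 1 : ℕ) : ℤ) := by
          congr 1; ext j; rw [geven]; push_cast; rfl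
      _ ≤ ∑' j : ℕ, g j :=
          ENNReal.tsum_comp_le_tsum_of_injective (f := fun j : ℕ => j + 1)
            (add_left_injective 1) (fun j : ℕ => g j)
  refine (hle.trans (add_le_add hnat hnat)).trans ?_
  have := quarterWeight_pos n
  rw [← ENNReal.ofReal_add (by positivity) (by positivity)]
  apply ENNReal.ofReal_le_ofReal
  linarith

/-- The bilinear Hilbert-type inequality behind the embedding `H^{1/4} ⊂ L⁴`. -/
lemma tsum_bilinear_le {x : ℤ → ℝ} (hx : ∀ n, 0 ≤ x n) :
    ∑' n : ℤ, ∑' m : ℤ, ENNReal.ofReal (x n * x m *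
      ((max (quarterWeight n) (quarterWeight m)) ^ 2)⁻¹) ≤
      32 * ∑' n : ℤ, ENNReal.ofReal ((quarterWeight n * x n) ^ 2) := by
  set A := quarterWeight with hA
  have Apos : ∀ n, 0 < A n := quarterWeight_pos
  set k : ℤ → ℤ → ℝ := fun n m => (A m ^ 3)⁻¹ * ((max (A n) (A m)) ^ 2)⁻¹ with hk
  have hpt : ∀ n m, ENNReal.ofReal (x n * x m * ((max (A n) (A m)) ^ 2)⁻¹) ≤
      ENNReal.ofReal (x n ^ 2 * A n ^ 3) * ENNReal.ofReal (k n m) +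
      ENNReal.ofReal (x m ^ 2 * A m ^ 3) * ENNReal.ofReal (k m n) := by
    intro n m
    have hn := Apos n
    have hm := Apos m
    have hxn := hx n
    have hxm := hx m
    have hM : 0 ≤ ((max (A n) (A m)) ^ 2)⁻¹ := by positivity
    rw [← ENNReal.ofReal_mul (by positivity), ← ENNReal.ofReal_mul (by positivity),
      ← ENNReal.ofReal_add (by positivity) (by positivity)]
    apply ENNReal.ofReal_le_ofReal
    simp only [hk]
    rw [max_comm (A m) (A n)]
    have key : x n * x m ≤ x n ^ 2 * A n ^ 3 * (A m ^ 3)⁻¹ + x m ^ 2 * A m ^ 3 * (A n ^ 3)⁻¹ := by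
      have e : x n ^ 2 * A n ^ 3 * (A m ^ 3)⁻¹ + x m ^ 2 * A m ^ 3 * (A n ^ 3)⁻¹ =
        ((x n * A n ^ 3) ^ 2 + (x m * A m ^ 3) ^ 2) / (A n ^ 3 * A m ^ 3) := by field_simp
      rw [e, le_div_iff₀ (by positivity)]
      have : 0 ≤ (x n * A n ^ 3) * (x m * A m ^ 3) := by positivity
      nlinarith [sq_nonneg (x n * A n ^ 3 - x m * A m ^ 3)]
    calc _ ≤ (x n ^ 2 * A n ^ 3 * (A m ^ 3)⁻¹ + x m ^ 2 * A m ^ 3 * (A n ^ 3)⁻¹) *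
        ((max (A n) (A m)) ^ 2)⁻¹ := by gcongr
      _ = _ := by ring
  have half : ∑' n : ℤ, ∑' m : ℤ, ENNReal.ofReal (x n ^ 2 * A n ^ 3) * ENNReal.ofReal (k n m) ≤
      16 * ∑' n : ℤ, ENNReal.ofReal ((A n * x n) ^ 2) := by
    rw [← ENNReal.tsum_mul_left]
    refine ENNReal.tsum_le_tsum fun n => ?_
    rw [ENNReal.tsum_mul_left]
    have hn := Apos n
    refine (mul_le_mul_right (tsum_schur_le n) _).trans ?_
    rw [← ENNReal.ofReal_mul (by positivity),
      show (16 : ENNReal) = ENNReal.ofReal 16 by norm_num, ← ENNReal.ofReal_mul (by norm_num)]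
    apply ENNReal.ofReal_le_ofReal
    apply le_of_eq
    rw [← hA]
    field_simp
  calc _ ≤ ∑' n : ℤ, ∑' m : ℤ, (ENNReal.ofReal (x n ^ 2 * A n ^ 3) * ENNReal.ofReal (k n m) +
      ENNReal.ofReal (x m ^ 2 * A m ^ 3) * ENNReal.ofReal (k m n)) :=
        ENNReal.tsum_le_tsum fun n => ENNReal.tsum_le_tsum fun m => hpt n m
    _ = ∑' n : ℤ, ∑' m : ℤ, ENNReal.ofReal (x n ^ 2 * A n ^ 3) * ENNReal.ofReal (k n m) +
        ∑' n : ℤ, ∑' m : ℤ, ENNReal.ofReal (x n ^ 2 * A n ^ 3) * ENNReal.ofReal (k n m) := by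
        simp_rw [ENNReal.tsum_add]
        congr 1
        rw [ENNReal.tsum_comm]
    _ ≤ _ := (add_le_add half half).trans (le_of_eq (by rw [← add_mul]; norm_num))

lemma tsum_convolution_le {y : ℤ → ℝ} (hy : ∀ n, 0 ≤ y n) (c : ℤ) :
    ∑' l : ℤ, ENNReal.ofReal (y l * y (-(c + l))) ≤ 2 * ∑' l : ℤ, ENNReal.ofReal (y l ^ 2) := by
  calc _ ≤ ∑' l : ℤ, (ENNReal.ofReal (y l ^ 2) + ENNReal.ofReal (y (-(c + l)) ^ 2)) := by
        refine ENNReal.tsum_le_tsum fun l => ?_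
        rw [← ENNReal.ofReal_add (by positivity) (by positivity)]
        apply ENNReal.ofReal_le_ofReal
        have := mul_nonneg (hy l) (hy (-(c + l)))
        nlinarith [sq_nonneg (y l - y (-(c + l)))]
    _ ≤ _ := by
        rw [ENNReal.tsum_add, two_mul]
        refine add_le_add le_rfl ?_
        exact ENNReal.tsum_comp_le_tsum_of_injective (f := fun l : ℤ => -(c + l))
          (fun a b h => by simpa using h) (fun l => ENNReal.ofReal (y l ^ 2))

/-- One of the six configurations, in which the two lowest frequencies are the first two. -/
def pairTerm (x : ℤ → ℝ) (n₁ n₂ n₃ n₄ : ℤ) : ℝ :=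
  x n₁ * x n₂ * ((max (quarterWeight n₁) (quarterWeight n₂)) ^ 2)⁻¹ *
    ((quarterWeight n₃ * x n₃) * (quarterWeight n₄ * x n₄))

lemma pairTerm_nonneg {x : ℤ → ℝ} (hx : ∀ n, 0 ≤ x n) (n₁ n₂ n₃ n₄ : ℤ) :
    0 ≤ pairTerm x n₁ n₂ n₃ n₄ := by
  have h₁ := hx n₁
  have h₂ := hx n₂
  have h₃ := hx n₃
  have h₄ := hx n₄
  have w₃ := quarterWeight_pos n₃
  have w₄ := quarterWeight_pos n₄
  unfold pairTerm
  positivity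

lemma mul_le_pairTerm {x : ℤ → ℝ} (hx : ∀ n, 0 ≤ x n) {n₁ n₂ n₃ n₄ : ℤ}
    (h₃ : max (quarterWeight n₁) (quarterWeight n₂) ≤ quarterWeight n₃)
    (h₄ : max (quarterWeight n₁) (quarterWeight n₂) ≤ quarterWeight n₄) :
    x n₁ * x n₂ * x n₃ * x n₄ ≤ pairTerm x n₁ n₂ n₃ n₄ := by
  have x₁ := hx n₁
  have x₂ := hx n₂
  have x₃ := hx n₃
  have x₄ := hx n₄
  unfold pairTerm
  set m := max (quarterWeight n₁) (quarterWeight n₂)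
  have hm : 0 < m := (quarterWeight_pos n₁).trans_le (le_max_left _ _)
  calc _ = x n₁ * x n₂ * (m ^ 2)⁻¹ * ((m * x n₃) * (m * x n₄)) := by field_simp
    _ ≤ _ := by
        have := (hm.trans_le h₃).le
        gcongr

lemma exists_pair_le (a b c d : ℝ) :
    (max a b ≤ c ∧ max a b ≤ d) ∨ (max a c ≤ b ∧ max a c ≤ d) ∨ (max b c ≤ a ∧ max b c ≤ d) ∨
    (max a d ≤ b ∧ max a d ≤ c) ∨ (max b d ≤ a ∧ max b d ≤ c) ∨ (max c d ≤ a ∧ max c d ≤ b) := by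
  simp only [max_le_iff]
  grind

lemma prod_le_sum_pairTerm {x : ℤ → ℝ} (hx : ∀ n, 0 ≤ x n) (n₁ n₂ n₃ n₄ : ℤ) :
    x n₁ * x n₂ * x n₃ * x n₄ ≤ pairTerm x n₁ n₂ n₃ n₄ + pairTerm x n₁ n₃ n₂ n₄ +
      pairTerm x n₂ n₃ n₁ n₄ + pairTerm x n₁ n₄ n₂ n₃ + pairTerm x n₂ n₄ n₁ n₃ +
      pairTerm x n₃ n₄ n₁ n₂ := by
  have t₁ := pairTerm_nonneg hx n₁ n₂ n₃ n₄
  have t₂ := pairTerm_nonneg hx n₁ n₃ n₂ n₄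
  have t₃ := pairTerm_nonneg hx n₂ n₃ n₁ n₄
  have t₄ := pairTerm_nonneg hx n₁ n₄ n₂ n₃
  have t₅ := pairTerm_nonneg hx n₂ n₄ n₁ n₃
  have t₆ := pairTerm_nonneg hx n₃ n₄ n₁ n₂
  rcases exists_pair_le (quarterWeight n₁) (quarterWeight n₂) (quarterWeight n₃)
    (quarterWeight n₄) with h | h | h | h | h | h <;>
  · have := mul_le_pairTerm hx h.1 h.2
    linarith

lemma tsum_pairTerm_le {x : ℤ → ℝ} (hx : ∀ n, 0 ≤ x n) :
    ∑' q : ℤ × ℤ × ℤ, ENNReal.ofReal (pairTerm x q.1 q.2.1 q.2.2 (-(q.1 + q.2.1 + q.2.2))) ≤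
      64 * (∑' n : ℤ, ENNReal.ofReal ((quarterWeight n * x n) ^ 2)) ^ 2 := by
  set E := ∑' n : ℤ, ENNReal.ofReal ((quarterWeight n * x n) ^ 2)
  rw [ENNReal.tsum_prod']
  simp_rw [ENNReal.tsum_prod']
  have hy : ∀ n, 0 ≤ quarterWeight n * x n := fun n => mul_nonneg (quarterWeight_pos n).le (hx n)
  calc _ ≤ ∑' n : ℤ, ∑' m : ℤ, ENNReal.ofReal (x n * x m *
        ((max (quarterWeight n) (quarterWeight m)) ^ 2)⁻¹) * (2 * E) := by
        refine ENNReal.tsum_le_tsum fun n => ENNReal.tsum_le_tsum fun m => ?_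
        have hnm : 0 ≤ x n * x m * ((max (quarterWeight n) (quarterWeight m)) ^ 2)⁻¹ := by
          have := hx n
          have := hx m
          positivity
        simp only [pairTerm, ENNReal.ofReal_mul hnm, ENNReal.tsum_mul_left]
        gcongr
        exact tsum_convolution_le hy (n + m)
    _ ≤ 32 * E * (2 * E) := by
        simp_rw [ENNReal.tsum_mul_right]
        gcongr
        exact tsum_bilinear_le hx
    _ = 64 * E ^ 2 := by ring

lemma tsum_quartic_le {x : ℤ → ℝ} (hx : ∀ n, 0 ≤ x n) :
    ∑' q : ℤ × ℤ × ℤ, ENNReal.ofReal (x q.1 * x q.2.1 * x q.2.2 * x (-(q.1 + q.2.1 + q.2.2))) ≤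
      384 * (∑' n : ℤ, ENNReal.ofReal ((quarterWeight n * x n) ^ 2)) ^ 2 := by
  set E := ∑' n : ℤ, ENNReal.ofReal ((quarterWeight n * x n) ^ 2) with hE
  set G : ℤ × ℤ × ℤ → ENNReal := fun q =>
    ENNReal.ofReal (pairTerm x q.1 q.2.1 q.2.2 (-(q.1 + q.2.1 + q.2.2))) with hG
  have hGle : ∑' q, G q ≤ 64 * E ^ 2 := tsum_pairTerm_le hx
  have reindex : ∀ φ : ℤ × ℤ × ℤ → ℤ × ℤ × ℤ, Function.Injective φ →
      ∑' q, G (φ q) ≤ 64 * E ^ 2 := fun φ hφ =>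
    (ENNReal.tsum_comp_le_tsum_of_injective hφ G).trans hGle
  have h₂ := reindex (fun q => (q.1, q.2.2, q.2.1)) (fun a b h => by
    simp only [Prod.mk.injEq] at h; ext <;> omega)
  have h₃ := reindex (fun q => (q.2.1, q.2.2, q.1)) (fun a b h => by
    simp only [Prod.mk.injEq] at h; ext <;> omega)
  have h₄ := reindex (fun q => (q.1, -(q.1 + q.2.1 + q.2.2), q.2.1)) (fun a b h => by
    simp only [Prod.mk.injEq] at h; ext <;> omega)
  have h₅ := reindex (fun q => (q.2.1, -(q.1 + q.2.1 + q.2.2), q.1)) (fun a b h => by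
    simp only [Prod.mk.injEq] at h; ext <;> omega)
  have h₆ := reindex (fun q => (q.2.2, -(q.1 + q.2.1 + q.2.2), q.1)) (fun a b h => by
    simp only [Prod.mk.injEq] at h; ext <;> omega)
  refine le_trans (ENNReal.tsum_le_tsum (g := fun q => G q + G (q.1, q.2.2, q.2.1) +
    G (q.2.1, q.2.2, q.1) + G (q.1, -(q.1 + q.2.1 + q.2.2), q.2.1) +
    G (q.2.1, -(q.1 + q.2.1 + q.2.2), q.1) + G (q.2.2, -(q.1 + q.2.1 + q.2.2), q.1)) ?_) ?_
  · rintro ⟨a, b, c⟩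
    have nn := pairTerm_nonneg hx
    simp only [hG]
    rw [show -(a + c + b) = -(a + b + c) by ring, show -(b + c + a) = -(a + b + c) by ring,
      show -(a + -(a + b + c) + b) = c by ring, show -(b + -(a + b + c) + a) = c by ring,
      show -(c + -(a + b + c) + a) = b by ring]
    rw [← ENNReal.ofReal_add, ← ENNReal.ofReal_add, ← ENNReal.ofReal_add, ← ENNReal.ofReal_add,
      ← ENNReal.ofReal_add]
    · exact ENNReal.ofReal_le_ofReal (prod_le_sum_pairTerm hx a b c _)
    all_goals first | exact nn _ _ _ _ | skip
    all_goals
      repeat' apply add_nonneg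
      all_goals exact nn _ _ _ _
  · simp only [ENNReal.tsum_add]
    refine (add_le_add (add_le_add (add_le_add (add_le_add (add_le_add hGle h₂) h₃) h₄) h₅)
      h₆).trans (le_of_eq ?_)
    ring

lemma quarterWeight_sq_le {s : ℝ} (hs : 1 / 4 ≤ s) (n : ℤ) :
    quarterWeight n ^ 2 ≤ 2 * hsWeight s n := by
  have h1 : (1 : ℝ) ≤ 1 + (n : ℝ) ^ 2 := by nlinarith [sq_nonneg (n : ℝ)]
  have h2 : (1 + (n : ℝ) ^ 2) ^ (1 / 4 : ℝ) ≤ hsWeight s n :=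
    Real.rpow_le_rpow_of_exponent_le h1 hs
  refine le_trans ?_ (mul_le_mul_of_nonneg_left h2 (by norm_num))
  have h0 := quarterWeight_pos n
  refine le_of_pow_le_pow_left₀ (n := 4) (by norm_num) (by positivity) ?_
  rw [mul_pow, ← Real.rpow_natCast (_ ^ (1 / 4 : ℝ)), ← Real.rpow_mul (by positivity),
    show (quarterWeight n ^ 2) ^ 4 = (quarterWeight n ^ 4) ^ 2 by ring, quarterWeight_pow_four]
  norm_num
  nlinarith [sq_abs (n : ℝ), sq_nonneg (|(n : ℝ)| - 1)]

lemma hsWeight_pos (s : ℝ) (n : ℤ) : 0 < hsWeight s n := by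
  unfold hsWeight; positivity

/-- The quartic form underlying the `L⁴` norm converges absolutely on `H^s`, `s ≥ 1/4`. -/
lemma summable_quartic {s : ℝ} (hs : 1 / 4 ≤ s) {x : ℤ → ℝ} (hx : ∀ n, 0 ≤ x n)
    (hsum : Summable fun n => hsWeight s n * x n ^ 2) :
    (Summable fun q : ℤ × ℤ × ℤ => x q.1 * x q.2.1 * x q.2.2 * x (-(q.1 + q.2.1 + q.2.2))) ∧
    ∑' q : ℤ × ℤ × ℤ, x q.1 * x q.2.1 * x q.2.2 * x (-(q.1 + q.2.1 + q.2.2)) ≤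
      1536 * (∑' n, hsWeight s n * x n ^ 2) ^ 2 := by
  have hnn : ∀ n, 0 ≤ hsWeight s n * x n ^ 2 := fun n => by
    have := hsWeight_pos s n
    positivity
  set H := ∑' n, hsWeight s n * x n ^ 2 with hH
  have H0 : 0 ≤ H := tsum_nonneg hnn
  have hE : ∑' n : ℤ, ENNReal.ofReal ((quarterWeight n * x n) ^ 2) ≤ ENNReal.ofReal (2 * H) := by
    rw [hH, ← tsum_mul_left, ENNReal.ofReal_tsum_of_nonneg (fun n => by have := hnn n; positivity)
      (hsum.mul_left 2)]
    refine ENNReal.tsum_le_tsum fun n => ENNReal.ofReal_le_ofReal ?_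
    rw [mul_pow, ← mul_assoc]
    have := quarterWeight_sq_le hs n
    gcongr
  have hQ := (tsum_quartic_le hx).trans (mul_le_mul_right (pow_le_pow_left' hE 2) _)
  rw [← ENNReal.ofReal_pow (by positivity), show (384 : ENNReal) = ENNReal.ofReal 384 by norm_num,
    ← ENNReal.ofReal_mul (by norm_num), show 384 * (2 * H) ^ 2 = 1536 * H ^ 2 by ring] at hQ
  have hf : ∀ q : ℤ × ℤ × ℤ, 0 ≤ x q.1 * x q.2.1 * x q.2.2 * x (-(q.1 + q.2.1 + q.2.2)) :=
    fun q => mul_nonneg (mul_nonneg (mul_nonneg (hx _) (hx _)) (hx _)) (hx _)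
  have hsm : Summable fun q : ℤ × ℤ × ℤ =>
      x q.1 * x q.2.1 * x q.2.2 * x (-(q.1 + q.2.1 + q.2.2)) := by
    have := ENNReal.summable_toReal (ne_top_of_le_ne_top ENNReal.ofReal_ne_top hQ)
    simpa only [ENNReal.toReal_ofReal (hf _)] using this
  refine ⟨hsm, ?_⟩
  rw [← ENNReal.ofReal_tsum_of_nonneg hf hsm] at hQ
  exact (ENNReal.ofReal_le_ofReal_iff (by positivity)).1 hQ

/-! ### Elementary properties of the `H^s` norm. -/

lemma hsWeight_mul_nonneg (s : ℝ) (a : ℤ → ℂ) (n : ℤ) : 0 ≤ hsWeight s n * ‖a n‖ ^ 2 := by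
  have := hsWeight_pos s n
  positivity

lemma hsNormSq_nonneg (s : ℝ) (a : ℤ → ℂ) : 0 ≤ hsNormSq s a :=
  tsum_nonneg (hsWeight_mul_nonneg s a)

lemma hsNorm_nonneg (s : ℝ) (a : ℤ → ℂ) : 0 ≤ hsNorm s a := Real.sqrt_nonneg _

lemma hsNorm_sq (s : ℝ) (a : ℤ → ℂ) : hsNorm s a ^ 2 = hsNormSq s a :=
  Real.sq_sqrt (hsNormSq_nonneg s a)

lemma hsNorm_congr {s : ℝ} {a b : ℤ → ℂ} (h : ∀ n, ‖a n‖ = ‖b n‖) : hsNorm s a = hsNorm s b := by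
  simp [hsNorm, hsNormSq, h]

lemma InHs.congr {s : ℝ} {a b : ℤ → ℂ} (ha : InHs s a) (h : ∀ n, ‖a n‖ = ‖b n‖) : InHs s b := by
  simpa [InHs, h] using ha

lemma hsNorm_sub_comm (s : ℝ) (a b : ℤ → ℂ) :
    hsNorm s (fun n => a n - b n) = hsNorm s (fun n => b n - a n) :=
  hsNorm_congr fun _ => norm_sub_rev _ _

lemma InHs.sub_and_hsNorm_sub_le {s : ℝ} {a b : ℤ → ℂ} (ha : InHs s a) (hb : InHs s b) :
    InHs s (fun n => a n - b n) ∧ hsNorm s (fun n => a n - b n) ≤ hsNorm s a + hsNorm s b := by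
  set y : (ℤ → ℂ) → ℤ → ℝ := fun c n => Real.sqrt (hsWeight s n) * ‖c n‖ with hy
  have y0 : ∀ c n, 0 ≤ y c n := fun c n => by simp only [hy]; positivity
  have ysq : ∀ c n, y c n ^ (2 : ℝ) = hsWeight s n * ‖c n‖ ^ 2 := fun c n => by
    rw [Real.rpow_two, mul_pow, Real.sq_sqrt (hsWeight_pos s n).le]
  obtain ⟨h1, h2⟩ := Real.Lp_add_le_tsum_of_nonneg (p := 2) (by norm_num) (y0 a) (y0 b)
    (by simpa only [ysq, InHs] using ha) (by simpa only [ysq, InHs] using hb)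
  have hle : ∀ n, hsWeight s n * ‖a n - b n‖ ^ 2 ≤ (y a n + y b n) ^ (2 : ℝ) := fun n => by
    rw [← ysq (fun n => a n - b n)]
    have := y0 (fun n => a n - b n) n
    gcongr
    simp only [hy, ← mul_add]
    gcongr
    exact norm_sub_le _ _
  have hsub : InHs s (fun n => a n - b n) :=
    Summable.of_nonneg_of_le (hsWeight_mul_nonneg s _) hle h1
  refine ⟨hsub, ?_⟩
  simp only [ysq, ← Real.sqrt_eq_rpow] at h2
  exact (Real.sqrt_le_sqrt (hsub.tsum_le_tsum hle h1)).trans h2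

lemma InHs.sub {s : ℝ} {a b : ℤ → ℂ} (ha : InHs s a) (hb : InHs s b) :
    InHs s (fun n => a n - b n) := (ha.sub_and_hsNorm_sub_le hb).1

lemma hsNorm_sub_le_add {s : ℝ} {a b c : ℤ → ℂ} (ha : InHs s a) (hb : InHs s b) (hc : InHs s c) :
    hsNorm s (fun n => a n - c n) ≤
      hsNorm s (fun n => a n - b n) + hsNorm s (fun n => b n - c n) := by
  have h := ((ha.sub hb).sub_and_hsNorm_sub_le (hc.sub hb)).2
  rw [hsNorm_sub_comm s b c]
  simpa using h

/-! ### Continuity of the quartic form. -/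

lemma norm_two_pi_inv_le : ‖((2 * Real.pi : ℝ) : ℂ)⁻¹‖ ≤ 1 := by
  rw [norm_inv, Complex.norm_real, Real.norm_eq_abs, abs_of_pos (by positivity)]
  apply inv_le_one_of_one_le₀
  linarith [Real.pi_gt_three]

lemma summable_l4pow {s : ℝ} (hs : 1 / 4 ≤ s) {a : ℤ → ℂ} (ha : InHs s a) :
    Summable fun q : ℤ × ℤ × ℤ => a q.1 * a q.2.1 * a q.2.2 * a (-(q.1 + q.2.1 + q.2.2)) := by
  refine Summable.of_norm ?_
  simpa only [norm_mul] using (summable_quartic hs (fun n => norm_nonneg (a n)) ha).1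

lemma norm_l4pow_le {s : ℝ} (hs : 1 / 4 ≤ s) {a : ℤ → ℂ} (ha : InHs s a) {R : ℝ}
    (hR : hsNorm s a ≤ R) : ‖l4pow a‖ ≤ 1536 * R ^ 4 := by
  obtain ⟨h1, h2⟩ := summable_quartic hs (fun n => norm_nonneg (a n)) ha
  rw [l4pow, norm_mul]
  calc _ ≤ 1 * ∑' q : ℤ × ℤ × ℤ,
        ‖a q.1‖ * ‖a q.2.1‖ * ‖a q.2.2‖ * ‖a (-(q.1 + q.2.1 + q.2.2))‖ := by
        refine mul_le_mul norm_two_pi_inv_le ?_ (norm_nonneg _) zero_le_one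
        exact tsum_of_norm_bounded h1.hasSum fun q => by simp only [norm_mul]; rfl
    _ ≤ 1536 * (hsNorm s a ^ 2) ^ 2 := by rw [one_mul, hsNorm_sq]; exact h2
    _ ≤ _ := by
        rw [← pow_mul]
        have := hsNorm_nonneg s a
        gcongr

lemma norm_prod_sub_prod_le {a₁ a₂ a₃ a₄ b₁ b₂ b₃ b₄ : ℂ} {r e₁ e₂ e₃ e₄ : ℝ} (hr : 0 < r)
    (hr1 : r ≤ 1) (h₁ : ‖a₁ - b₁‖ = r * e₁) (h₂ : ‖a₂ - b₂‖ = r * e₂)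
    (h₃ : ‖a₃ - b₃‖ = r * e₃) (h₄ : ‖a₄ - b₄‖ = r * e₄) :
    ‖a₁ * a₂ * a₃ * a₄ - b₁ * b₂ * b₃ * b₄‖ ≤
      r * ((‖a₁‖ + e₁) * (‖a₂‖ + e₂) * (‖a₃‖ + e₃) * (‖a₄‖ + e₄)) := by
  have aux : ∀ {a b : ℂ} {e : ℝ}, ‖a - b‖ = r * e → 0 ≤ e ∧ ‖b‖ ≤ ‖a‖ + e := by
    intro a b e h
    have he : 0 ≤ e := nonneg_of_mul_nonneg_right (h ▸ norm_nonneg (a - b)) hr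
    refine ⟨he, ?_⟩
    have h1 := norm_le_norm_add_norm_sub a b
    have h2 : r * e ≤ 1 * e := by gcongr
    linarith
  obtain ⟨p₁, q₁⟩ := aux h₁
  obtain ⟨p₂, q₂⟩ := aux h₂
  obtain ⟨p₃, q₃⟩ := aux h₃
  obtain ⟨p₄, q₄⟩ := aux h₄
  have e : a₁ * a₂ * a₃ * a₄ - b₁ * b₂ * b₃ * b₄ = (a₁ - b₁) * a₂ * a₃ * a₄ +
      b₁ * (a₂ - b₂) * a₃ * a₄ + b₁ * b₂ * (a₃ - b₃) * a₄ + b₁ * b₂ * b₃ * (a₄ - b₄) := by ring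
  rw [e]
  have n₁ := norm_nonneg a₁
  have n₂ := norm_nonneg a₂
  have n₃ := norm_nonneg a₃
  have n₄ := norm_nonneg a₄
  calc _ ≤ (r * e₁) * ‖a₂‖ * ‖a₃‖ * ‖a₄‖ + ‖b₁‖ * (r * e₂) * ‖a₃‖ * ‖a₄‖ +
        ‖b₁‖ * ‖b₂‖ * (r * e₃) * ‖a₄‖ + ‖b₁‖ * ‖b₂‖ * ‖b₃‖ * (r * e₄) := by
        refine (norm_add_le _ _).trans (add_le_add ((norm_add_le _ _).trans
          (add_le_add ((norm_add_le _ _).trans (add_le_add ?_ ?_)) ?_)) ?_) <;>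
        simp only [norm_mul, h₁, h₂, h₃, h₄, le_refl]
    _ ≤ (r * e₁) * ‖a₂‖ * ‖a₃‖ * ‖a₄‖ + (‖a₁‖ + e₁) * (r * e₂) * ‖a₃‖ * ‖a₄‖ +
        (‖a₁‖ + e₁) * (‖a₂‖ + e₂) * (r * e₃) * ‖a₄‖ +
        (‖a₁‖ + e₁) * (‖a₂‖ + e₂) * (‖a₃‖ + e₃) * (r * e₄) := by gcongr
    _ = r * ((‖a₁‖ + e₁) * (‖a₂‖ + e₂) * (‖a₃‖ + e₃) * (‖a₄‖ + e₄)) -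
        r * (‖a₁‖ * ‖a₂‖ * ‖a₃‖ * ‖a₄‖) := by ring
    _ ≤ _ := sub_le_self _ (by positivity)

lemma norm_l4pow_sub_le {s : ℝ} (hs : 1 / 4 ≤ s) {a b : ℤ → ℂ} (ha : InHs s a) (hb : InHs s b)
    {R r : ℝ} (hR : hsNorm s a ≤ R) (hr : 0 < r) (hr1 : r ≤ 1)
    (hab : hsNorm s (fun n => a n - b n) ≤ r) :
    ‖l4pow a - l4pow b‖ ≤ 1536 * (2 * R ^ 2 + 2) ^ 2 * r := by
  set x : ℤ → ℝ := fun n => ‖a n‖ + ‖a n - b n‖ / r with hx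
  have x0 : ∀ n, 0 ≤ x n := fun n => by simp only [hx]; positivity
  have hd : Summable fun n => 2 * (hsWeight s n * ‖a n‖ ^ 2) +
      2 / r ^ 2 * (hsWeight s n * ‖a n - b n‖ ^ 2) :=
    (ha.mul_left 2).add ((ha.sub hb).mul_left (2 / r ^ 2))
  have hle : ∀ n, hsWeight s n * x n ^ 2 ≤ 2 * (hsWeight s n * ‖a n‖ ^ 2) +
      2 / r ^ 2 * (hsWeight s n * ‖a n - b n‖ ^ 2) := fun n => by
    have h1 : x n ^ 2 ≤ 2 * (‖a n‖ ^ 2 + (‖a n - b n‖ / r) ^ 2) := add_sq_le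
    calc _ ≤ hsWeight s n * (2 * (‖a n‖ ^ 2 + (‖a n - b n‖ / r) ^ 2)) :=
          mul_le_mul_of_nonneg_left h1 (hsWeight_pos s n).le
      _ = _ := by rw [div_pow]; ring
  have hw : ∀ n, 0 ≤ hsWeight s n * x n ^ 2 := fun n => by
    have := hsWeight_pos s n
    positivity
  have hxs : Summable fun n => hsWeight s n * x n ^ 2 := Summable.of_nonneg_of_le hw hle hd
  have hH : ∑' n, hsWeight s n * x n ^ 2 ≤ 2 * R ^ 2 + 2 := by
    refine (hxs.tsum_le_tsum hle hd).trans ?_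
    rw [(ha.mul_left 2).tsum_add ((ha.sub hb).mul_left (2 / r ^ 2)), tsum_mul_left, tsum_mul_left]
    have e1 : ∑' n, hsWeight s n * ‖a n‖ ^ 2 ≤ R ^ 2 := by
      rw [← hsNormSq, ← hsNorm_sq]
      exact pow_le_pow_left₀ (hsNorm_nonneg _ _) hR 2
    have e2 : ∑' n, hsWeight s n * ‖a n - b n‖ ^ 2 ≤ r ^ 2 := by
      change hsNormSq s (fun n => a n - b n) ≤ r ^ 2
      rw [← hsNorm_sq]
      exact pow_le_pow_left₀ (hsNorm_nonneg _ _) hab 2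
    have e3 : 2 / r ^ 2 * ∑' n, hsWeight s n * ‖a n - b n‖ ^ 2 ≤ 2 / r ^ 2 * r ^ 2 := by gcongr
    rw [div_mul_cancel₀ _ (by positivity)] at e3
    linarith
  obtain ⟨h1, h2⟩ := summable_quartic hs x0 hxs
  rw [l4pow, l4pow, ← mul_sub, norm_mul,
    ← (summable_l4pow hs ha).tsum_sub (summable_l4pow hs hb)]
  calc _ ≤ 1 * (r * ∑' q : ℤ × ℤ × ℤ,
        x q.1 * x q.2.1 * x q.2.2 * x (-(q.1 + q.2.1 + q.2.2))) := by
        refine mul_le_mul norm_two_pi_inv_le ?_ (norm_nonneg _) zero_le_one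
        refine tsum_of_norm_bounded (h1.hasSum.mul_left r) fun q => ?_
        have hdiv : ∀ n, ‖a n - b n‖ = r * (‖a n - b n‖ / r) := fun n => by field_simp
        exact norm_prod_sub_prod_le hr hr1 (hdiv _) (hdiv _) (hdiv _) (hdiv _)
    _ ≤ 1 * (r * (1536 * (2 * R ^ 2 + 2) ^ 2)) := by
        have h3 : (∑' n, hsWeight s n * x n ^ 2) ^ 2 ≤ (2 * R ^ 2 + 2) ^ 2 :=
          pow_le_pow_left₀ (tsum_nonneg hw) hH 2
        have h4 := h2.trans (mul_le_mul_of_nonneg_left h3 (by norm_num))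
        rw [one_mul, one_mul]
        exact mul_le_mul_of_nonneg_left h4 hr.le
    _ = _ := by ring

lemma conj_l4pow {a : ℤ → ℂ} (ha : IsRealCoeff a) : conj (l4pow a) = l4pow a := by
  rw [l4pow, map_mul, map_inv₀, Complex.conj_ofReal, Complex.conj_tsum]
  congr 1
  rw [← (Equiv.neg (ℤ × ℤ × ℤ)).tsum_eq]
  refine tsum_congr fun q => ?_
  simp only [map_mul, ha _, Equiv.neg_apply, Prod.fst_neg, Prod.snd_neg, neg_neg]
  congr 2
  ring

/-! ### The phase rotations. -/

/-- Translation by `20 h`, on the Fourier side. -/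
def phase (h : ℝ) (a : ℤ → ℂ) : ℤ → ℂ := fun n => Complex.exp (-(20 : ℂ) * I * (n : ℂ) * h) * a n

lemma norm_exp_phase (h : ℝ) (n : ℤ) : ‖Complex.exp (-(20 : ℂ) * I * (n : ℂ) * h)‖ = 1 := by
  rw [show -(20 : ℂ) * I * (n : ℂ) * h = ((-20 * n * h : ℝ) : ℂ) * I by push_cast; ring]
  exact Complex.norm_exp_ofReal_mul_I _

lemma norm_phase (h : ℝ) (a : ℤ → ℂ) (n : ℤ) : ‖phase h a n‖ = ‖a n‖ := by
  rw [phase, norm_mul, norm_exp_phase, one_mul]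

lemma phase_phase (h k : ℝ) (a : ℤ → ℂ) : phase h (phase k a) = phase (h + k) a := by
  funext n
  simp only [phase]
  rw [← mul_assoc, ← Complex.exp_add]
  congr 2
  push_cast
  ring

lemma phase_zero (a : ℤ → ℂ) : phase 0 a = a := by
  funext n
  simp [phase]

lemma phase_sub (h : ℝ) (a b : ℤ → ℂ) (n : ℤ) :
    phase h a n - phase h b n = phase h (fun n => a n - b n) n := by
  simp only [phase]
  ring

lemma InHs.phase {s : ℝ} {a : ℤ → ℂ} (ha : InHs s a) (h : ℝ) : InHs s (phase h a) :=
  ha.congr fun n => (norm_phase h a n).symm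

lemma hsNorm_phase (s h : ℝ) (a : ℤ → ℂ) : hsNorm s (phase h a) = hsNorm s a :=
  hsNorm_congr (norm_phase h a)

lemma hsNorm_phase_sub_phase (s h : ℝ) (a b : ℤ → ℂ) :
    hsNorm s (fun n => phase h a n - phase h b n) = hsNorm s (fun n => a n - b n) := by
  simp only [phase_sub]
  exact hsNorm_phase s h _

lemma IsRealCoeff.phase {a : ℤ → ℂ} (ha : IsRealCoeff a) (h : ℝ) : IsRealCoeff (phase h a) := by
  intro n
  simp only [MKdV5.phase, map_mul, ← Complex.exp_conj, ha n, map_neg, Complex.conj_I,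
    Complex.conj_ofReal, map_ofNat, map_intCast, Int.cast_neg]
  congr 2
  ring

lemma l4pow_phase (h : ℝ) (a : ℤ → ℂ) : l4pow (phase h a) = l4pow a := by
  rw [l4pow, l4pow]
  congr 1
  refine tsum_congr fun q => ?_
  set c : ℤ → ℂ := fun n => Complex.exp (-(20 : ℂ) * I * (n : ℂ) * h) with hc
  have e : c q.1 * c q.2.1 * c q.2.2 * c (-(q.1 + q.2.1 + q.2.2)) = 1 := by
    simp only [hc, ← Complex.exp_add]
    rw [Complex.exp_eq_one_iff]
    refine ⟨0, ?_⟩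
    push_cast
    ring
  calc _ = (c q.1 * c q.2.1 * c q.2.2 * c (-(q.1 + q.2.1 + q.2.2))) *
        (a q.1 * a q.2.1 * a q.2.2 * a (-(q.1 + q.2.1 + q.2.2))) := by
        simp only [phase, hc]
        ring
    _ = _ := by rw [e, one_mul]

/-- Strong continuity of the translation group on `H^s`. -/
lemma tendsto_hsNorm_phase_sub {s : ℝ} {a : ℤ → ℂ} (ha : InHs s a) :
    Filter.Tendsto (fun h => hsNorm s (fun n => phase h a n - a n)) (nhds 0) (nhds 0) := by
  have key : Filter.Tendsto (fun h : ℝ => ∑' n, hsWeight s n * ‖phase h a n - a n‖ ^ 2) (nhds 0)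
      (nhds (∑' _ : ℤ, (0 : ℝ))) := by
    refine tendsto_tsum_of_dominated_convergence (bound := fun n => 4 * (hsWeight s n * ‖a n‖ ^ 2))
      (ha.mul_left 4) (fun n => ?_) (Filter.Eventually.of_forall fun h n => ?_)
    · have hcont : Continuous fun h : ℝ => hsWeight s n * ‖phase h a n - a n‖ ^ 2 := by
        unfold phase
        fun_prop
      simpa [phase_zero] using hcont.tendsto 0
    · rw [Real.norm_of_nonneg (hsWeight_mul_nonneg s (fun n => phase h a n - a n) n)]
      have h1 : ‖phase h a n - a n‖ ≤ 2 * ‖a n‖ := by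
        have := norm_sub_le (phase h a n) (a n)
        rw [norm_phase] at this
        linarith
      have := hsWeight_pos s n
      calc _ ≤ hsWeight s n * (2 * ‖a n‖) ^ 2 := by gcongr
        _ = _ := by ring
  rw [tsum_zero] at key
  simpa [hsNorm, hsNormSq] using key.sqrt

lemma ContHs.exists_forall_hsNorm_phase_sub_lt {s T : ℝ} {u : ℝ → ℤ → ℂ} (hu : ContHs s T u)
    {ε : ℝ} (hε : 0 < ε) : ∃ η > 0, ∀ t ∈ Icc (-T) T, ∀ h : ℝ, |h| < η →
      hsNorm s (fun n => phase h (u t) n - u t n) < ε := by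
  suffices H : ∃ η > 0, ∀ t ∈ Icc (-T) T, t ∈ Icc (-T) T → ∀ h : ℝ, |h| < η →
      hsNorm s (fun n => phase h (u t) n - u t n) < ε by
    obtain ⟨η, hη, H⟩ := H
    exact ⟨η, hη, fun t ht => H t ht ht⟩
  refine isCompact_Icc.induction_on (p := fun S => ∃ η > 0, ∀ t ∈ S, t ∈ Icc (-T) T →
    ∀ h : ℝ, |h| < η → hsNorm s (fun n => phase h (u t) n - u t n) < ε)
    ⟨1, one_pos, by simp⟩ ?_ ?_ ?_
  · rintro S S' hS ⟨η, hη, H⟩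
    exact ⟨η, hη, fun t ht => H t (hS ht)⟩
  · rintro S S' ⟨η, hη, H⟩ ⟨η', hη', H'⟩
    refine ⟨min η η', lt_min hη hη', fun t ht hT h hh => ?_⟩
    rcases ht with ht | ht
    · exact H t ht hT h (hh.trans_le (min_le_left _ _))
    · exact H' t ht hT h (hh.trans_le (min_le_right _ _))
  · intro t ht
    obtain ⟨η, hη, H⟩ := Metric.tendsto_nhds_nhds.1 (tendsto_hsNorm_phase_sub (hu.1 t ht)) (ε / 3)
      (by positivity)
    obtain ⟨δ, hδ, D⟩ := hu.2 t ht (ε / 3) (by positivity)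
    refine ⟨_, mem_nhdsWithin_of_mem_nhds (Metric.ball_mem_nhds t hδ), η, hη,
      fun t' hball ht' h hh => ?_⟩
    have d := D t' ht' (by simpa [Real.dist_eq] using hball)
    have p := H (x := h) (by simpa [Real.dist_eq] using hh)
    rw [Real.dist_eq, sub_zero, abs_of_nonneg (hsNorm_nonneg _ _)] at p
    have i := hu.1 t ht
    have i' := hu.1 t' ht'
    have s1 := hsNorm_sub_le_add (i'.phase h) (i.phase h) i'
    have s2 := hsNorm_sub_le_add (i.phase h) i i'
    rw [hsNorm_phase_sub_phase] at s1
    rw [hsNorm_sub_comm s (u t) (u t')] at s2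
    linarith

/-! ### The phase angle of the gauge transformation. -/

/-- The angle `∫₀ᵗ ‖u(τ)‖_{L⁴}⁴ dτ`. -/
def angle (u : ℝ → ℤ → ℂ) (t : ℝ) : ℝ := ∫ τ in (0 : ℝ)..t, (l4pow (u τ)).re

lemma InBallCHs.continuousOn_l4pow {s T R : ℝ} (hs : 1 / 4 ≤ s) {u : ℝ → ℤ → ℂ}
    (hu : InBallCHs s T R u) : ContinuousOn (fun t => (l4pow (u t)).re) (Icc (-T) T) := by
  refine Complex.continuous_re.comp_continuousOn ?_
  rw [Metric.continuousOn_iff]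
  intro t ht ε hε
  set C := 1536 * (2 * R ^ 2 + 2) ^ 2 with hC
  have C0 : 0 < C := by positivity
  set r := min 1 (ε / (2 * C)) with hr
  have r0 : 0 < r := by positivity
  obtain ⟨δ, hδ, D⟩ := hu.1.2 t ht r r0
  refine ⟨δ, hδ, fun t' ht' hd => ?_⟩
  have d := D t' ht' hd
  have := norm_l4pow_sub_le hs (hu.1.1 t' ht') (hu.1.1 t ht) (hu.2.2 t' ht') r0 (min_le_left _ _)
    d.le
  rw [dist_eq_norm]
  have h2 : C * r ≤ C * (ε / (2 * C)) := by gcongr; exact min_le_right _ _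
  have h3 : C * (ε / (2 * C)) = ε / 2 := by field_simp
  linarith

lemma InBallCHs.intervalIntegrable_l4pow {s T R : ℝ} (hs : 1 / 4 ≤ s) {u : ℝ → ℤ → ℂ}
    (hu : InBallCHs s T R u) {t t' : ℝ} (ht : t ∈ Icc (-T) T) (ht' : t' ∈ Icc (-T) T) :
    IntervalIntegrable (fun τ => (l4pow (u τ)).re) volume t t' :=
  ((hu.continuousOn_l4pow hs).mono (uIcc_subset_Icc ht ht')).intervalIntegrable

lemma zero_mem_Icc_neg {T : ℝ} (hT : 0 < T) : (0 : ℝ) ∈ Icc (-T) T := ⟨by linarith, hT.le⟩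

lemma InBallCHs.gauge_eq {s T R : ℝ} (hT : 0 < T) {u : ℝ → ℤ → ℂ}
    (hu : InBallCHs s T R u) {t : ℝ} (ht : t ∈ Icc (-T) T) :
    gauge u t = phase (angle u t) (u t) := by
  funext n
  rw [gauge, phase, angle, ← intervalIntegral.integral_ofReal]
  congr 3
  refine intervalIntegral.integral_congr fun τ hτ => ?_
  exact (Complex.conj_eq_iff_re.1
    (conj_l4pow (hu.2.1 τ (uIcc_subset_Icc (zero_mem_Icc_neg hT) ht hτ)))).symm

lemma InBallCHs.abs_angle_sub_angle_le {s T R : ℝ} (hs : 1 / 4 ≤ s) (hT : 0 < T)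
    {u : ℝ → ℤ → ℂ} (hu : InBallCHs s T R u) {t t' : ℝ} (ht : t ∈ Icc (-T) T)
    (ht' : t' ∈ Icc (-T) T) : |angle u t' - angle u t| ≤ 1536 * R ^ 4 * |t' - t| := by
  have h0 := zero_mem_Icc_neg hT
  rw [angle, angle, intervalIntegral.integral_interval_sub_left
    (hu.intervalIntegrable_l4pow hs h0 ht') (hu.intervalIntegrable_l4pow hs h0 ht),
    ← Real.norm_eq_abs]
  refine intervalIntegral.norm_integral_le_of_norm_le_const fun τ hτ => ?_
  have hτ' := uIcc_subset_Icc ht ht' (uIoc_subset_uIcc hτ)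
  exact (Complex.abs_re_le_norm _).trans (norm_l4pow_le hs (hu.1.1 τ hτ') (hu.2.2 τ hτ'))

lemma InBallCHs.abs_angle_sub_le {s T R : ℝ} (hs : 1 / 4 ≤ s) (hT : 0 < T)
    {u v : ℝ → ℤ → ℂ} (hu : InBallCHs s T R u) (hv : InBallCHs s T R v) {r : ℝ} (hr : 0 < r)
    (hr1 : r ≤ 1) (huv : ∀ t ∈ Icc (-T) T, hsNorm s (fun n => u t n - v t n) ≤ r) {t : ℝ}
    (ht : t ∈ Icc (-T) T) : |angle u t - angle v t| ≤ 1536 * (2 * R ^ 2 + 2) ^ 2 * r * T := by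
  have h0 := zero_mem_Icc_neg hT
  rw [angle, angle, ← intervalIntegral.integral_sub
    (hu.intervalIntegrable_l4pow hs h0 ht) (hv.intervalIntegrable_l4pow hs h0 ht),
    ← Real.norm_eq_abs]
  refine (intervalIntegral.norm_integral_le_of_norm_le_const (C := 1536 * (2 * R ^ 2 + 2) ^ 2 * r)
    fun τ hτ => ?_).trans ?_
  · have hτ' := uIcc_subset_Icc h0 ht (uIoc_subset_uIcc hτ)
    rw [← Complex.sub_re]
    exact (Complex.abs_re_le_norm _).trans
      (norm_l4pow_sub_le hs (hu.1.1 τ hτ') (hv.1.1 τ hτ') (hu.2.2 τ hτ') hr hr1 (huv τ hτ'))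
  · rw [sub_zero]
    gcongr
    exact abs_le.2 ht

lemma hsNorm_phase_sub_phase_le {s : ℝ} {a b : ℤ → ℂ} (ha : InHs s a) (hb : InHs s b) (h k : ℝ) :
    hsNorm s (fun n => phase h a n - phase k b n) ≤
      hsNorm s (fun n => phase (h - k) a n - a n) + hsNorm s (fun n => a n - b n) := by
  have h1 := hsNorm_sub_le_add (ha.phase h) (ha.phase k) (hb.phase k)
  rw [hsNorm_phase_sub_phase] at h1
  have e : hsNorm s (fun n => phase h a n - phase k a n) =
      hsNorm s (fun n => phase (h - k) a n - a n) := by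
    rw [← hsNorm_phase_sub_phase s k (phase (h - k) a), phase_phase, add_sub_cancel]
  rwa [e] at h1

lemma InBallCHs.gauge {s T R : ℝ} (hs : 1 / 4 ≤ s) (hT : 0 < T) {u : ℝ → ℤ → ℂ}
    (hu : InBallCHs s T R u) : InBallCHs s T R (gauge u) := by
  refine ⟨⟨fun t ht => ?_, fun t ht ε hε => ?_⟩, fun t ht => ?_, fun t ht => ?_⟩
  · rw [hu.gauge_eq hT ht]
    exact (hu.1.1 t ht).phase _
  · obtain ⟨η, hη, H⟩ := hu.1.exists_forall_hsNorm_phase_sub_lt (half_pos hε)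
    obtain ⟨δ, hδ, D⟩ := hu.1.2 t ht (ε / 2) (half_pos hε)
    set M := 1536 * R ^ 4 + 1 with hM
    have M0 : 0 < M := by positivity
    refine ⟨min δ (η / M), by positivity, fun t' ht' hd => ?_⟩
    rw [hu.gauge_eq hT ht, hu.gauge_eq hT ht']
    have h1 := hsNorm_phase_sub_phase_le (hu.1.1 t' ht') (hu.1.1 t ht) (angle u t') (angle u t)
    have h2 := D t' ht' (hd.trans_le (min_le_left _ _))
    have h3 := H t' ht' (angle u t' - angle u t) (by
      have hd' := hd.trans_le (min_le_right _ _)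
      rw [lt_div_iff₀ M0] at hd'
      have := hu.abs_angle_sub_angle_le hs hT ht ht'
      nlinarith [abs_nonneg (t' - t)])
    linarith
  · rw [hu.gauge_eq hT ht]
    exact (hu.2.1 t ht).phase _
  · rw [hu.gauge_eq hT ht, hsNorm_phase]
    exact hu.2.2 t ht

lemma InBallCHs.l4pow_gauge {s T R : ℝ} (hT : 0 < T) {u : ℝ → ℤ → ℂ}
    (hu : InBallCHs s T R u) {t : ℝ} (ht : t ∈ Icc (-T) T) :
    l4pow (MKdV5.gauge u t) = l4pow (u t) := by
  rw [hu.gauge_eq hT ht, l4pow_phase]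

lemma InBallCHs.angle_gauge {s T R : ℝ} (hT : 0 < T) {u : ℝ → ℤ → ℂ}
    (hu : InBallCHs s T R u) {t : ℝ} (ht : t ∈ Icc (-T) T) :
    angle (MKdV5.gauge u) t = angle u t := by
  refine intervalIntegral.integral_congr fun τ hτ => ?_
  simp only [hu.l4pow_gauge hT (uIcc_subset_Icc (zero_mem_Icc_neg hT) ht hτ)]

lemma InBallCHs.phase_neg_angle_gauge {s T R : ℝ} (hT : 0 < T) {u : ℝ → ℤ → ℂ}
    (hu : InBallCHs s T R u) {t : ℝ} (ht : t ∈ Icc (-T) T) :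
    phase (-angle (MKdV5.gauge u) t) (MKdV5.gauge u t) = u t := by
  rw [hu.angle_gauge hT ht, hu.gauge_eq hT ht, phase_phase, neg_add_cancel, phase_zero]

lemma InBallCHs.hsNorm_sub_le_supDistHs {s T R : ℝ} {u v : ℝ → ℤ → ℂ} (hu : InBallCHs s T R u)
    (hv : InBallCHs s T R v) {t : ℝ} (ht : t ∈ Icc (-T) T) :
    hsNorm s (fun n => u t n - v t n) ≤ supDistHs s T u v := by
  refine le_csSup ⟨R + R, ?_⟩ ⟨t, ht, rfl⟩
  rintro _ ⟨τ, hτ, rfl⟩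
  exact ((hu.1.1 τ hτ).sub_and_hsNorm_sub_le (hv.1.1 τ hτ)).2.trans
    (add_le_add (hu.2.2 τ hτ) (hv.2.2 τ hτ))

/-- Rotating by a fixed multiple `c` of the angle is continuous on balls. -/
lemma InBallCHs.exists_forall_hsNorm_phase_angle_sub_le {s T R : ℝ} (hs : 1 / 4 ≤ s) (hT : 0 < T)
    {u : ℝ → ℤ → ℂ} (hu : InBallCHs s T R u) (c : ℝ) {ε : ℝ} (hε : 0 < ε) :
    ∃ δ > 0, ∀ v, InBallCHs s T R v → supDistHs s T u v < δ → ∀ t ∈ Icc (-T) T,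
      hsNorm s (fun n => phase (c * angle u t) (u t) n - phase (c * angle v t) (v t) n) ≤ ε := by
  obtain ⟨η, hη, H⟩ := hu.1.exists_forall_hsNorm_phase_sub_lt (half_pos hε)
  set C := |c| * (1536 * (2 * R ^ 2 + 2) ^ 2 * T) + 1 with hC
  have C0 : 0 < C := by positivity
  set r := min (min 1 (ε / 2)) (η / (2 * C)) with hr
  have r0 : 0 < r := by positivity
  refine ⟨r, r0, fun v hv hd t ht => ?_⟩
  have hle : ∀ t ∈ Icc (-T) T, hsNorm s (fun n => u t n - v t n) ≤ r := fun t ht =>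
    (hu.hsNorm_sub_le_supDistHs hv ht).trans hd.le
  have h1 := hsNorm_phase_sub_phase_le (hu.1.1 t ht) (hv.1.1 t ht) (c * angle u t) (c * angle v t)
  have h2 : r ≤ ε / 2 := (min_le_left _ _).trans (min_le_right _ _)
  have h3 := H t ht (c * angle u t - c * angle v t) (by
    have ha := hu.abs_angle_sub_le hs hT hv r0 ((min_le_left _ _).trans (min_le_left _ _)) hle ht
    have hb : r * (2 * C) ≤ η := (le_div_iff₀ (by positivity)).1 (min_le_right _ _)
    rw [← mul_sub, abs_mul]
    calc _ ≤ |c| * (1536 * (2 * R ^ 2 + 2) ^ 2 * r * T) := by gcongr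
      _ = (C - 1) * r := by rw [hC]; ring
      _ < η := by nlinarith [mul_pos r0 C0])
  linarith [hle t ht]

lemma supDistHs_le {s T : ℝ} (hT : 0 < T) {u v : ℝ → ℤ → ℂ} {ε : ℝ}
    (h : ∀ t ∈ Icc (-T) T, hsNorm s (fun n => u t n - v t n) ≤ ε) : supDistHs s T u v ≤ ε := by
  refine csSup_le ⟨_, 0, zero_mem_Icc_neg hT, rfl⟩ ?_
  rintro _ ⟨t, ht, rfl⟩
  exact h t ht

/-- **Bi-continuity of the gauge transformation `NT`** (Lemma A.4): on each closed ball of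
real-valued functions in `C([-T,T];H^s(𝕋))`, `s ≥ 1/4`, the map `NT` takes values in
`C([-T,T];H^s(𝕋))`, is injective, and both `NT` and its inverse are continuous. -/
theorem gauge_bicontinuous (s T R : ℝ) (hs : 1 / 4 ≤ s) (hT : 0 < T) (hR : 0 < R) :
    (∀ u : ℝ → ℤ → ℂ, InBallCHs s T R u →
      ContHs s T (gauge u) ∧ ∀ t ∈ Icc (-T) T, IsRealCoeff (gauge u t)) ∧
    (∀ u v : ℝ → ℤ → ℂ, InBallCHs s T R u → InBallCHs s T R v →
      (∀ t ∈ Icc (-T) T, ∀ n : ℤ, gauge u t n = gauge v t n) →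
      ∀ t ∈ Icc (-T) T, ∀ n : ℤ, u t n = v t n) ∧
    (∀ u : ℝ → ℤ → ℂ, InBallCHs s T R u → ∀ ε > (0:ℝ), ∃ δ > (0:ℝ),
      ∀ v : ℝ → ℤ → ℂ, InBallCHs s T R v →
        supDistHs s T u v < δ → supDistHs s T (gauge u) (gauge v) < ε) ∧
    (∀ u : ℝ → ℤ → ℂ, InBallCHs s T R u → ∀ ε > (0:ℝ), ∃ δ > (0:ℝ),
      ∀ v : ℝ → ℤ → ℂ, InBallCHs s T R v →
        supDistHs s T (gauge u) (gauge v) < δ → supDistHs s T u v < ε) := by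
  refine ⟨fun u hu => ⟨(hu.gauge hs hT).1, (hu.gauge hs hT).2.1⟩, fun u v hu hv h t ht n => ?_,
    fun u hu ε hε => ?_, fun u hu ε hε => ?_⟩
  · have e : ∀ τ ∈ Icc (-T) T, gauge u τ = gauge v τ := fun τ hτ => funext (h τ hτ)
    have hang : angle (gauge u) t = angle (gauge v) t := by
      refine intervalIntegral.integral_congr fun τ hτ => ?_
      simp only [e τ (uIcc_subset_Icc (zero_mem_Icc_neg hT) ht hτ)]
    rw [← hu.phase_neg_angle_gauge hT ht, ← hv.phase_neg_angle_gauge hT ht, hang, e t ht]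
  · obtain ⟨δ, hδ, H⟩ := hu.exists_forall_hsNorm_phase_angle_sub_le hs hT 1 (half_pos hε)
    refine ⟨δ, hδ, fun v hv hd => (supDistHs_le hT fun t ht => ?_).trans_lt (half_lt_self hε)⟩
    rw [hu.gauge_eq hT ht, hv.gauge_eq hT ht]
    simpa only [one_mul] using H v hv hd t ht
  · obtain ⟨δ, hδ, H⟩ :=
      (hu.gauge hs hT).exists_forall_hsNorm_phase_angle_sub_le hs hT (-1) (half_pos hε)
    refine ⟨δ, hδ, fun v hv hd => (supDistHs_le hT fun t ht => ?_).trans_lt (half_lt_self hε)⟩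
    simpa only [neg_one_mul, hu.phase_neg_angle_gauge hT ht, hv.phase_neg_angle_gauge hT ht]
      using H (gauge v) (hv.gauge hs hT) hd t ht

end MKdV5
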